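/- For any triple (A,B,C) whose indices α_i, β_j^(μ), γ_l are all distinct and satisfy α_i < α_{i+1}, β_i^0 < β_i^1, β_i^ν < β_{i+1}^ν, β_i^0 < α_1, β_i^1 < α_3, γ_i < γ_{i+1}, the map G_{A,B,C} preserves the Grassmann cone: if ω ∈ ⋀^p k^n is decomposable, then G_{A,B,C}(ω) ∈ ⋀^2 k^4 is decomposable. -/

import Mathlib

open ExteriorAlgebra

noncomputable section

variable (k : Type*) [Field k]

/-- The alternating map giving the coordinate `Π_idx` (antisymmetric in `idx`). -/
def coordA {n : ℕ} (q : ℕ) (idx : Fin q → Fin n) :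
    (Fin n → k) [⋀^Fin q]→ₗ[k] k :=
  (Matrix.detRowAlternating : (Fin q → k) [⋀^Fin q]→ₗ[k] k).compLinearMap
    (LinearMap.funLeft k k idx)

/-- The coordinate functional `Π_idx` on the exterior algebra. -/
def coordF {n : ℕ} (q : ℕ) (idx : Fin q → Fin n) :
    ExteriorAlgebra k (Fin n → k) →ₗ[k] k :=
  ExteriorAlgebra.liftAlternating
    (Function.update (fun i => (0 : (Fin n → k) [⋀^Fin i]→ₗ[k] k)) q (coordA k q idx))

/-- Decomposability of an element of the exterior algebra, in degree `q`. -/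
def IsDecomp {n : ℕ} (q : ℕ) (x : ExteriorAlgebra k (Fin n → k)) : Prop :=
  ∃ v : Fin q → (Fin n → k), x = ExteriorAlgebra.ιMulti k q v

/-- The dual isomorphism `δ` on the degree-`p` part, with values in degree `n-p`. -/
def dualAt (n p : ℕ) (ω : ExteriorAlgebra k (Fin n → k)) :
    ExteriorAlgebra k (Fin n → k) :=
  ∑ s : {s : Finset (Fin n) // s.card = p},
    coordF k p (fun a => (s.1.orderIsoOfFin s.2 a : Fin n)) ω •
      ExteriorAlgebra.ιMulti k (n - p)
        (fun a => Pi.single (((s.1ᶜ).orderIsoOfFin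
          (by rw [Finset.card_compl, s.2, Fintype.card_fin]) a : Fin n)) (1 : k))

/-- The index tuple `(α_i, α_j, β_1^{ε_1}, …, β_m^{ε_m}, γ_1, …, γ_c)`. -/
def tupleP {n : ℕ} (m c : ℕ) (α : Fin 4 → Fin n) (β : Fin m → Fin 2 → Fin n)
    (γ : Fin c → Fin n) (i j : Fin 4) (ε : Fin m → Fin 2) : Fin (2 + (m + c)) → Fin n :=
  Fin.append ![α i, α j] (Fin.append (fun l => β l (ε l)) γ)

/-- The functional `π_{ij} = Π_{α_i α_j β⃗_1 … β⃗_m γ_1 … γ_c}`. -/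
def piF {n : ℕ} (m c : ℕ) (α : Fin 4 → Fin n) (β : Fin m → Fin 2 → Fin n)
    (γ : Fin c → Fin n) (i j : Fin 4) :
    ExteriorAlgebra k (Fin n → k) →ₗ[k] k :=
  ∑ ε : Fin m → Fin 2, coordF k (2 + (m + c)) (tupleP m c α β γ i j ε)

/-- The rank 6 quadratic form `P'_{A,B,C}`. -/
def Pprime {n : ℕ} (m c : ℕ) (α : Fin 4 → Fin n) (β : Fin m → Fin 2 → Fin n)
    (γ : Fin c → Fin n) (ω : ExteriorAlgebra k (Fin n → k)) : k :=
  piF k m c α β γ 0 1 ω * piF k m c α β γ 2 3 ω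
    - piF k m c α β γ 0 2 ω * piF k m c α β γ 1 3 ω
    + piF k m c α β γ 0 3 ω * piF k m c α β γ 1 2 ω

/-- The ordering/distinctness conditions on the triple `(A,B,C)`. -/
def OrderedABC {n : ℕ} (m c : ℕ) (α : Fin 4 → Fin n) (β : Fin m → Fin 2 → Fin n)
    (γ : Fin c → Fin n) : Prop :=
  Function.Injective (Sum.elim α (Sum.elim (fun x : Fin m × Fin 2 => β x.1 x.2) γ)) ∧
    StrictMono α ∧ (∀ l, β l 0 < β l 1) ∧
    (∀ ν : Fin 2, StrictMono fun l => β l ν) ∧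
    (∀ l, β l 0 < α 0) ∧ (∀ l, β l 1 < α 2) ∧ StrictMono γ

/-- The set `S' = A ∪ B_1 ∪ C`. -/
def SP {n : ℕ} (m c : ℕ) (α : Fin 4 → Fin n) (β : Fin m → Fin 2 → Fin n)
    (γ : Fin c → Fin n) : Finset (Fin n) :=
  Finset.univ.image α ∪ Finset.univ.image (fun l => β l 1) ∪ Finset.univ.image γ

open Classical in
/-- The matrix of the map `X_{A,B,C} : k^n → k^{p+2}`. -/
def Xmat (p : ℕ) {n : ℕ} (m c : ℕ) (α : Fin 4 → Fin n) (β : Fin m → Fin 2 → Fin n)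
    (γ : Fin c → Fin n) : Matrix (Fin (p + 2)) (Fin n) k :=
  if h : (SP m c α β γ).card = p + 2 then
    fun j i =>
      (if i = ((SP m c α β γ).orderIsoOfFin h j : Fin n) then 1 else 0) +
        ∑ l : Fin m,
          if i = β l 0 ∧ β l 1 = ((SP m c α β γ).orderIsoOfFin h j : Fin n) then 1 else 0
  else 0

/-- The linear map `X_{A,B,C} : k^n → k^{p+2}`. -/
def XL (p : ℕ) {n : ℕ} (m c : ℕ) (α : Fin 4 → Fin n) (β : Fin m → Fin 2 → Fin n)
    (γ : Fin c → Fin n) : (Fin n → k) →ₗ[k] (Fin (p + 2) → k) :=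
  (Xmat k p m c α β γ).mulVecLin

open Classical in
/-- The matrix of the map `Z : k^{p+2} → k^4`. -/
def Zmat (p : ℕ) {n : ℕ} (m c : ℕ) (α : Fin 4 → Fin n) (β : Fin m → Fin 2 → Fin n)
    (γ : Fin c → Fin n) : Matrix (Fin 4) (Fin (p + 2)) k :=
  fun j i => if XL k p m c α β γ (Pi.single (α j) 1) = Pi.single i 1 then 1 else 0

/-- The linear map `Z : k^{p+2} → k^4`. -/
def ZL (p : ℕ) {n : ℕ} (m c : ℕ) (α : Fin 4 → Fin n) (β : Fin m → Fin 2 → Fin n)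
    (γ : Fin c → Fin n) : (Fin (p + 2) → k) →ₗ[k] (Fin 4 → k) :=
  (Zmat k p m c α β γ).mulVecLin

/-- The Grassmann cone preserving map `G_{A,B,C} = ⋀²Z ∘ δ ∘ ⋀^p X_{A,B,C}`. -/
def GABC (p : ℕ) {n : ℕ} (m c : ℕ) (α : Fin 4 → Fin n) (β : Fin m → Fin 2 → Fin n)
    (γ : Fin c → Fin n) (ω : ExteriorAlgebra k (Fin n → k)) :
    ExteriorAlgebra k (Fin 4 → k) :=
  ExteriorAlgebra.map (ZL k p m c α β γ)
    (dualAt k (p + 2) p (ExteriorAlgebra.map (XL k p m c α β γ) ω))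

/-- The general Plücker quadratic form `P_{A,B}` for index sequences
`a : Fin d → Fin n` and `b : Fin (e+1) → Fin n`. -/
def Pluecker {n : ℕ} (d e : ℕ) (a : Fin d → Fin n) (b : Fin (e + 1) → Fin n)
    (ω : ExteriorAlgebra k (Fin n → k)) : k :=
  ∑ i : Fin (e + 1), (-1 : k) ^ (i : ℕ) *
    (coordF k (d + 1) (Fin.snoc a (b i)) ω * coordF k e (fun j => b (i.succAbove j)) ω)

theorem coordF_ιMulti {k : Type*} [Field k] {n q : ℕ} (idx : Fin q → Fin n)
    (v : Fin q → Fin n → k) :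
    coordF k q idx (ιMulti k q v) = Matrix.det fun a b => v a (idx b) := by
  simp only [coordF, liftAlternating_apply_ιMulti, Function.update_self, coordA]
  rfl

/-- The alternating bilinear form `(x, y) ↦ det (x, y, v_1, …, v_p)`. -/
def completionForm {k : Type*} [Field k] {p : ℕ} (v : Fin p → Fin (p + 2) → k)
    (x y : Fin (p + 2) → k) : k :=
  (((Matrix.detRowAlternating :
    (Fin (p + 2) → k) [⋀^Fin (p + 2)]→ₗ[k] k).curryLeft x).curryLeft y) v

section completionForm

variable {k : Type*} [Field k] {p : ℕ} (v : Fin p → Fin (p + 2) → k)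

theorem completionForm_eq_det (x y : Fin (p + 2) → k) :
    completionForm v x y = Matrix.det (Matrix.of (Matrix.vecCons x (Matrix.vecCons y v))) := rfl

theorem completionForm_self (x : Fin (p + 2) → k) : completionForm v x x = 0 := by
  rw [completionForm_eq_det]
  exact Matrix.det_zero_of_row_eq (i := 0) (j := 1) (by simp) rfl

theorem completionForm_apply_left (l : Fin p) (y : Fin (p + 2) → k) :
    completionForm v (v l) y = 0 := by
  rw [completionForm_eq_det]
  exact Matrix.det_zero_of_row_eq (i := 0) (j := l.succ.succ)
    (Fin.succ_ne_zero _).symm rfl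

theorem completionForm_swap (x y : Fin (p + 2) → k) :
    completionForm v x y = -completionForm v y x := by
  have h := completionForm_self v (x + y)
  have hx := completionForm_self v x
  have hy := completionForm_self v y
  simp only [completionForm, map_add, AlternatingMap.curryLeft_add, AlternatingMap.add_apply]
    at h hx hy ⊢
  change _ + _ + (_ + _) = (0 : k) at h
  linear_combination h - hx - hy

/-- The form `completionForm v` has rank at most two. -/
theorem completionForm_mul_completionForm (x₀ y₀ x y : Fin (p + 2) → k)
    (h : completionForm v x₀ y₀ ≠ 0) :
    completionForm v x₀ y₀ * completionForm v x y =
      completionForm v x y₀ * completionForm v x₀ y -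
        completionForm v x₀ x * completionForm v y y₀ := by
  set A : Matrix (Fin (p + 2)) (Fin (p + 2)) k :=
    Matrix.of (Matrix.vecCons x₀ (Matrix.vecCons y₀ v))
  have hdet : IsUnit A.det := by
    rw [completionForm_eq_det] at h
    exact h.isUnit
  obtain ⟨a, b, c, rfl⟩ : ∃ (a b : k) (c : Fin p → k),
      x = a • x₀ + (b • y₀ + ∑ l, c l • v l) := by
    have hx : Matrix.vecMul (Matrix.vecMul x A⁻¹) A = x := by
      rw [Matrix.vecMul_vecMul, Matrix.nonsing_inv_mul _ hdet, Matrix.vecMul_one]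
    rw [Matrix.vecMul_eq_sum, Fin.sum_univ_succ, Fin.sum_univ_succ] at hx
    exact ⟨_, _, _, hx.symm⟩
  have hl (z : Fin (p + 2) → k) :
      completionForm v (a • x₀ + (b • y₀ + ∑ l, c l • v l)) z =
        a * completionForm v x₀ z + b * completionForm v y₀ z := by
    have h0 := fun l => completionForm_apply_left v l z
    let L : (Fin (p + 2) → k) →ₗ[k] k :=
      { toFun := fun x => completionForm v x z
        map_add' := fun x y => by simp [completionForm]
        map_smul' := fun r x => by simp [completionForm] }
    change L _ = a * L x₀ + b * L y₀
    change ∀ l, L (v l) = 0 at h0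
    simp [h0]
  rw [completionForm_swap v x₀ (_ + _), hl, hl, hl, completionForm_self, completionForm_self,
    completionForm_swap v y₀ y, completionForm_swap v y₀ x₀]
  ring

/-- On basis vectors `completionForm v` gives the signed complementary minors of `v`. -/
theorem completionForm_single_single (s : Finset (Fin (p + 2))) (hs : s.card = p)
    {i j : Fin (p + 2)} (hij : i < j) (hsij : s = {i, j}ᶜ) :
    completionForm v (Pi.single j 1) (Pi.single i 1) =
      (-1) ^ (i + j : ℕ) * Matrix.det fun a b => v a (s.orderIsoOfFin hs b) := by
  have hi : i ≠ Fin.last _ := (hij.trans_le (Fin.le_last j)).ne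
  have hi' : j.succAbove (i.castPred hi) = i := by
    rw [Fin.succAbove_of_castSucc_lt _ _ (by simpa using hij), Fin.castSucc_castPred]
  have hidx : (fun b : Fin p => ((s.orderIsoOfFin hs b : s) : Fin (p + 2))) =
      j.succAbove ∘ (i.castPred hi).succAbove := by
    symm
    refine Finset.orderEmbOfFin_unique hs (fun b => ?_)
      ((Fin.strictMono_succAbove j).comp (Fin.strictMono_succAbove _))
    simp only [hsij, Finset.mem_compl, Finset.mem_insert, Finset.mem_singleton, not_or,
      Function.comp_apply]
    refine ⟨fun hb => ?_, Fin.succAbove_ne _ _⟩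
    exact Fin.succAbove_ne _ _ (Fin.succAbove_right_injective (hb.trans hi'.symm))
  rw [completionForm_eq_det, Matrix.det_succ_row_zero, Finset.sum_eq_single j _ (by simp)]
  · rw [Matrix.det_succ_row_zero, Finset.sum_eq_single (i.castPred hi) _ (by simp)]
    · have hd : (fun a b => v a (s.orderIsoOfFin hs b)) =
          fun a b => v a ((j.succAbove ∘ (i.castPred hi).succAbove) b) := by
        rw [← hidx]
      rw [hd]
      simp [hi', pow_add, Matrix.submatrix]
      rw [← mul_assoc, mul_comm ((-1) ^ (j : ℕ))]
      rfl
    · intro b _ hb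
      have : j.succAbove b ≠ i := fun h =>
        hb (Fin.succAbove_right_injective (h.trans hi'.symm))
      simp [this]
  · intro b _ hb
    simp [hb]

end completionForm

theorem ιMulti_two_eq_sum {k : Type*} [Field k] {n : ℕ} (F G : Fin n → k) :
    ιMulti k 2 ![F, G] = ∑ x : Fin n × Fin n with x.1 < x.2,
      (F x.1 * G x.2 - F x.2 * G x.1) •
        ιMulti k 2 ![(Pi.single x.1 1 : Fin n → k), Pi.single x.2 1] := by
  have hmul (u w : Fin n → k) : ιMulti k 2 ![u, w] = ι k u * ι k w := by
    simp [ιMulti_apply]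
  have hs (F : Fin n → k) : ι k F = ∑ i, F i • ι k (Pi.single i 1 : Fin n → k) := by
    conv_lhs => rw [pi_eq_sum_univ' F]
    simp only [map_sum, map_smul]
  simp only [hmul]
  set T : Fin n → Fin n → ExteriorAlgebra k (Fin n → k) :=
    fun i j => ι k (Pi.single i 1) * ι k (Pi.single j 1) with hT
  have hself (i) : T i i = 0 := ι_sq_zero _
  have hswap (i j) : T j i = -T i j := eq_neg_of_add_eq_zero_left (ι_add_mul_swap _ _)
  have hprod : ι k F * ι k G = ∑ x : Fin n × Fin n, (F x.1 * G x.2) • T x.1 x.2 := by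
    rw [hs F, hs G, Finset.sum_mul_sum, Fintype.sum_prod_type]
    simp only [hT, smul_mul_smul_comm]
  have hge : ∑ x : Fin n × Fin n with ¬x.1 < x.2, (F x.1 * G x.2) • T x.1 x.2 =
      ∑ x : Fin n × Fin n with x.1 < x.2, (F x.2 * G x.1) • T x.2 x.1 := by
    have hsub : (Finset.univ.filter fun x : Fin n × Fin n => x.2 < x.1) ⊆
        Finset.univ.filter fun x => ¬x.1 < x.2 := fun x hx => by
      simp only [Finset.mem_filter, Finset.mem_univ, true_and] at hx ⊢
      exact hx.not_gt
    rw [← Finset.sum_subset hsub fun x hx hx' => ?_]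
    · exact Finset.sum_equiv (Equiv.prodComm _ _) (by simp) (by simp)
    · simp only [Finset.mem_filter, Finset.mem_univ, true_and] at hx hx'
      rw [le_antisymm (not_lt.1 hx') (not_lt.1 hx), hself, smul_zero]
  rw [hprod, ← Finset.sum_filter_add_sum_filter_not _ (fun x => x.1 < x.2), hge,
    ← Finset.sum_add_distrib]
  refine Finset.sum_congr rfl fun x _ => ?_
  change _ = _ • T x.1 x.2
  rw [hswap x.1 x.2, smul_neg, sub_smul, sub_eq_add_neg]

/-- The dual of `v_1 ∧ ⋯ ∧ v_p`, as a sum over pairs `i < j`. -/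
theorem dualAt_eq_sum {k : Type*} [Field k] {p : ℕ} (v : Fin p → Fin (p + 2) → k) :
    dualAt k (p + 2) p (ιMulti k p v) =
      ∑ x : Fin (p + 2) × Fin (p + 2) with x.1 < x.2,
        ((-1) ^ (x.1 + x.2 : ℕ) * completionForm v (Pi.single x.2 1) (Pi.single x.1 1)) •
          ιMulti k 2 ![(Pi.single x.1 1 : Fin (p + 2) → k), Pi.single x.2 1] := by
  have hcard {x : Fin (p + 2) × Fin (p + 2)} (hx : x.1 < x.2) :
      (({x.1, x.2} : Finset (Fin (p + 2)))ᶜ).card = p := by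
    rw [Finset.card_compl, Finset.card_pair hx.ne, Fintype.card_fin, Nat.add_sub_cancel]
  symm
  refine Finset.sum_bij (fun x hx => ⟨{x.1, x.2}ᶜ, hcard (Finset.mem_filter.1 hx).2⟩)
    (fun _ _ => Finset.mem_univ _) ?_ ?_ ?_
  · rintro ⟨i, j⟩ hij ⟨i', j'⟩ hij' h
    simp only [Finset.mem_filter, Finset.mem_univ, true_and] at hij hij'
    simp only [Subtype.mk.injEq, compl_inj_iff, Finset.ext_iff, Finset.mem_insert,
      Finset.mem_singleton] at h
    have h1 := h i
    have h2 := h j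
    have h3 := h i'
    have h4 := h j'
    grind
  · rintro ⟨s, hs⟩ -
    have hsc : sᶜ.card = 2 := by
      rw [Finset.card_compl, hs, Fintype.card_fin, Nat.add_sub_cancel_left]
    obtain ⟨i, j, hij, h⟩ := Finset.card_eq_two.1 hsc
    rcases hij.lt_or_gt with hij | hij
    · exact ⟨(i, j), by simpa using hij, by simp [← h]⟩
    · exact ⟨(j, i), by simpa using hij, by simp [Finset.pair_comm j i, ← h]⟩
  · rintro ⟨i, j⟩ hij
    replace hij : i < j := by simpa using hij
    congr 1
    · rw [completionForm_single_single v _ (hcard (x := (i, j)) hij) hij rfl, coordF_ιMulti,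
        ← mul_assoc, ← pow_add, Even.neg_one_pow ⟨_, rfl⟩, one_mul]
    · have key : ∀ (q : ℕ) (hq : q = 2)
          (hc : (({i, j} : Finset (Fin (p + 2)))ᶜᶜ).card = q),
          ιMulti k 2 ![(Pi.single i 1 : Fin (p + 2) → k), Pi.single j 1] =
            ιMulti k q fun a => Pi.single
              (((({i, j} : Finset (Fin (p + 2)))ᶜᶜ).orderIsoOfFin hc a : Fin (p + 2))) 1 := by
        rintro q rfl hc
        have h : ![i, j] = (({i, j} : Finset (Fin (p + 2)))ᶜᶜ).orderEmbOfFin hc :=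
          Finset.orderEmbOfFin_unique hc (by simp [Fin.forall_fin_two])
            (by simpa [Fin.strictMono_iff_lt_succ] using hij)
        congr 1
        funext a
        rw [Finset.coe_orderIsoOfFin_apply, ← h]
        fin_cases a <;> rfl
      exact key _ (Nat.add_sub_cancel_left p 2) _

/-- The unsigned duality `⋀^p k^{p+2} → ⋀² k^{p+2}` preserves decomposability. -/
theorem isDecomp_dualAt {k : Type*} [Field k] {p : ℕ} (v : Fin p → Fin (p + 2) → k) :
    IsDecomp k 2 (dualAt k (p + 2) p (ιMulti k p v)) := by
  rw [dualAt_eq_sum]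
  by_cases h : ∃ x₀ y₀, completionForm v x₀ y₀ ≠ 0
  · obtain ⟨x₀, y₀, h⟩ := h
    refine ⟨![fun i => (-1) ^ (i : ℕ) * completionForm v x₀ (Pi.single i 1),
      fun i => (-1) ^ (i : ℕ) * ((completionForm v x₀ y₀)⁻¹ *
        completionForm v (Pi.single i 1) y₀)], ?_⟩
    rw [ιMulti_two_eq_sum]
    refine Finset.sum_congr rfl fun x _ => ?_
    congr 1
    have hrank := completionForm_mul_completionForm v x₀ y₀ (Pi.single x.2 1) (Pi.single x.1 1) h
    field_simp
    linear_combination (-1) ^ (x.1 + x.2 : ℕ) * hrank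
  · push Not at h
    exact ⟨0, by simp [h, AlternatingMap.map_zero]⟩

/-- For any ordered triple `(A,B,C)`, the map `G_{A,B,C}` preserves the
Grassmann cone: decomposable elements map to decomposable elements of `⋀² k⁴`. -/
theorem GABC_decomposable_of_decomposable
    {k : Type*} [Field k] {p n : ℕ} (m c : ℕ)
    (α : Fin 4 → Fin n) (β : Fin m → Fin 2 → Fin n) (γ : Fin c → Fin n)
    (hmc : 2 + (m + c) = p) (hord : OrderedABC m c α β γ)
    (ω : ⋀[k]^p (Fin n → k)) (hω : IsDecomp k p ω.val) :
    IsDecomp k 2 (GABC k p m c α β γ ω.val) := by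
  obtain ⟨v, hv⟩ := hω
  obtain ⟨u, hu⟩ := isDecomp_dualAt (XL k p m c α β γ ∘ v)
  exact ⟨ZL k p m c α β γ ∘ u, by
    rw [GABC, hv, map_apply_ιMulti, hu, map_apply_ιMulti]⟩

end
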